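/- Fix integers ν ≥ d ≥ 2. There exists a constant C = C(ν) > 0 such that for every integer h ≥ 3 and every algebraic number σ ∈ ℂ of degree d over ℚ, the number M_ν(h,σ) of nontrivial solutions of (x_1+σ)⋯(x_ν+σ) = (y_1+σ)⋯(y_ν+σ) ≠ 0 with integers 1 ≤ x_i, y_i ≤ h satisfies M_ν(h,σ) ≤ h^{ν−d+1}·exp(C·log h/log log h). -/

import Mathlib

open Polynomial in
theorem exists_int_polynomial_dvd_iff_aeval_eq_zero {σ : ℂ} (hσ : IsIntegral ℚ σ) :
    ∃ f : ℤ[X], f.natDegree = (minpoly ℚ σ).natDegree ∧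
      ∀ P : ℤ[X], aeval σ P = 0 ↔ f ∣ P := by
  obtain ⟨b, hb, hmap⟩ :=
    IsLocalization.integerNormalization_spec (nonZeroDivisors ℤ) (minpoly ℚ σ)
  set g := IsLocalization.integerNormalization (nonZeroDivisors ℤ) (minpoly ℚ σ) with hg
  have hb0 : (b : ℚ) ≠ 0 := by exact_mod_cast nonZeroDivisors.ne_zero hb
  have hmap' : g.map (algebraMap ℤ ℚ) = C (b : ℚ) * minpoly ℚ σ := by
    rw [hmap, ← Polynomial.smul_eq_C_mul]
    ext n; simp
  have hg0 : g ≠ 0 := by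
    intro h0
    rw [h0, Polynomial.map_zero] at hmap'
    exact mul_ne_zero (by simpa using hb0) (minpoly.ne_zero hσ) hmap'.symm
  have hc0 : (g.content : ℚ) ≠ 0 := by
    exact_mod_cast (mt content_eq_zero_iff.1 hg0)
  have hprim : C (g.content : ℚ) * g.primPart.map (algebraMap ℤ ℚ) = C (b : ℚ) * minpoly ℚ σ := by
    rw [← hmap']
    conv_rhs => rw [g.eq_C_content_mul_primPart]
    simp
  have hassoc : Associated (g.primPart.map (algebraMap ℤ ℚ)) (minpoly ℚ σ) := by
    have h1 : IsUnit (C (g.content : ℚ)) := isUnit_C.2 (isUnit_iff_ne_zero.2 hc0)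
    have h2 : IsUnit (C (b : ℚ)) := isUnit_C.2 (isUnit_iff_ne_zero.2 hb0)
    exact (associated_unit_mul_left _ _ h1).symm.trans
      (hprim ▸ associated_unit_mul_left _ _ h2)
  refine ⟨g.primPart, ?_, fun P => ?_⟩
  · rw [← natDegree_map_eq_of_injective (algebraMap ℤ ℚ).injective_int g.primPart]
    exact natDegree_eq_of_degree_eq (degree_eq_degree_of_associated hassoc)
  · rw [(isPrimitive_primPart g).dvd_iff_fraction_map_dvd_fraction_map ℚ, hassoc.dvd_iff_dvd_left,
      minpoly.dvd_iff, aeval_map_algebraMap]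

theorem exists_perm_of_multiset_map_eq {ι α : Type*} [Fintype ι] [DecidableEq α] {x y : ι → α}
    (h : Finset.univ.val.map x = Finset.univ.val.map y) :
    ∃ e : Equiv.Perm ι, ∀ i, y i = x (e i) := by
  have hcard (a : α) : Fintype.card {i // y i = a} = Fintype.card {i // x i = a} := by
    have := congrArg (Multiset.count a) h
    rw [Multiset.count_map, Multiset.count_map] at this
    rw [Fintype.card_subtype, Fintype.card_subtype, Finset.card_def, Finset.card_def,
      Finset.filter_val, Finset.filter_val]
    simpa only [eq_comm] using this.symm
  let e : Equiv.Perm ι := (Equiv.sigmaFiberEquiv y).symm.trans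
    ((Equiv.sigmaCongrRight fun a => Fintype.equivOfCardEq (hcard a)).trans
      (Equiv.sigmaFiberEquiv x))
  refine ⟨e, fun i => ?_⟩
  exact ((Fintype.equivOfCardEq (hcard (y i))) ⟨i, rfl⟩).2.symm

open Polynomial Metric in
/-- Dividing a complex polynomial by linear factors shrinks its bound on a disc by `δ` per factor,
at the cost of decreasing the radius of the disc. -/
theorem norm_eval_mul_pow_le_of_prod_mul (s : Multiset ℂ) (G : ℂ[X]) {R B δ : ℝ} (hδ : 0 < δ)
    (h : ∀ z : ℂ, ‖z‖ ≤ R → ‖((s.map fun r => X - C r).prod * G).eval z‖ ≤ B) (z : ℂ)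
    (hz : ‖z‖ ≤ R - 3 * δ * Multiset.card s) : ‖G.eval z‖ * δ ^ Multiset.card s ≤ B := by
  induction s using Multiset.induction_on generalizing R B with
  | empty => simpa using h z (by simpa using hz)
  | cons r s ih =>
    have hcard : 0 ≤ 3 * δ * (Multiset.card s : ℝ) := by positivity
    rw [Multiset.card_cons] at hz ⊢
    push_cast at hz
    have hz0 := norm_nonneg z
    obtain ⟨ρ, hρ0, hρR, hρ, hr⟩ : ∃ ρ, 0 < ρ ∧ ρ ≤ R ∧ R - 3 * δ ≤ ρ ∧ δ ≤ |ρ - ‖r‖| := by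
      by_cases hr : δ ≤ |R - ‖r‖|
      · exact ⟨R, by nlinarith, le_rfl, by linarith, hr⟩
      · refine ⟨R - 2 * δ, by nlinarith, by linarith, by linarith, ?_⟩
        rw [not_le, abs_lt] at hr
        rw [le_abs]
        right
        linarith
    set H := (s.map fun r => X - C r).prod * G with hH
    have key (w : ℂ) (hw : ‖w‖ ≤ R - 3 * δ) : ‖H.eval w‖ ≤ B / δ := by
      refine Complex.norm_le_of_forall_mem_frontier_norm_le (U := ball 0 ρ) isBounded_ball
        (f := fun w => H.eval w) H.differentiable.diffContOnCl (fun v hv => ?_) ?_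
      · rw [frontier_ball _ hρ0.ne', mem_sphere_zero_iff_norm] at hv
        have h1 := h v (by linarith)
        rw [Multiset.map_cons, Multiset.prod_cons, mul_assoc, ← hH, eval_mul, norm_mul] at h1
        have h2 : δ ≤ ‖(X - C r).eval v‖ := by
          simp only [eval_sub, eval_X, eval_C]
          exact hr.trans (hv ▸ abs_norm_sub_norm_le v r)
        rw [le_div_iff₀ hδ, mul_comm]
        exact (mul_le_mul_of_nonneg_right h2 (norm_nonneg _)).trans h1
      · rw [closure_ball _ hρ0.ne', mem_closedBall_zero_iff]
        linarith
    have := ih key (by linarith)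
    rw [le_div_iff₀ hδ] at this
    rwa [pow_succ, ← mul_assoc]

open Polynomial in
/-- The polynomial `∏ (X + xᵢ)`. -/
noncomputable def linProd {n : ℕ} (x : Fin n → ℤ) : ℤ[X] := ∏ i, (X + C (x i))

/-- The integer vectors with all coordinates in `[1, h]`. -/
noncomputable def intBox (n h : ℕ) : Finset (Fin n → ℤ) :=
  Fintype.piFinset fun _ => Finset.Icc 1 (h : ℤ)

theorem mem_intBox {n h : ℕ} {x : Fin n → ℤ} : x ∈ intBox n h ↔ ∀ i, 1 ≤ x i ∧ x i ≤ h := by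
  simp [intBox]

theorem eval_neg_linProd {n : ℕ} (x : Fin n → ℤ) (t : ℤ) :
    (linProd x).eval (-t) = ∏ i, (x i - t) := by
  simp only [linProd, Polynomial.eval_prod, Polynomial.eval_add, Polynomial.eval_X,
    Polynomial.eval_C]
  exact Finset.prod_congr rfl fun i _ => by ring

theorem eval_neg_linProd_self {n : ℕ} (x : Fin n → ℤ) (i : Fin n) :
    (linProd x).eval (-x i) = 0 := by
  rw [eval_neg_linProd]
  exact Finset.prod_eq_zero (Finset.mem_univ i) (sub_self _)

open Polynomial in
theorem aeval_linProd {n : ℕ} (x : Fin n → ℤ) (z : ℂ) :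
    aeval z (linProd x) = ∏ i, ((x i : ℂ) + z) := by
  simp [linProd, add_comm]

open Polynomial in
theorem linProd_insertNth {n : ℕ} (i : Fin (n + 1)) (v : ℤ) (x : Fin n → ℤ) :
    linProd (i.insertNth v x) = (X + C v) * linProd x := by
  simp [linProd, Fin.prod_univ_succAbove _ i]

open Polynomial in
theorem exists_perm_of_linProd_eq {n : ℕ} {x y : Fin n → ℤ} (h : linProd x = linProd y) :
    ∃ e : Equiv.Perm (Fin n), ∀ i, y i = x (e i) := by
  have hroots (x : Fin n → ℤ) : (linProd x).roots = (Finset.univ.val.map x).map Neg.neg := by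
    have : linProd x = (((Finset.univ.val.map x).map Neg.neg).map fun a => X - C a).prod := by
      simp [linProd, Function.comp_def, Finset.prod]
    rw [this, roots_multiset_prod_X_sub_C]
  apply exists_perm_of_multiset_map_eq
  exact Multiset.map_injective neg_injective (by rw [← hroots, ← hroots, h])

open Polynomial in
theorem map_intCast_eq_leadingCoeff_mul_prod_roots (f : ℤ[X]) :
    f.map (Int.castRingHom ℂ) = C (f.leadingCoeff : ℂ) *
      ((f.map (Int.castRingHom ℂ)).roots.map fun r => X - C r).prod := by
  conv_lhs => rw [(IsAlgClosed.splits (f.map (Int.castRingHom ℂ))).eq_prod_roots]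
  rw [leadingCoeff_map_of_injective (RingHom.injective_int _)]
  simp

open Polynomial in
theorem card_roots_map_intCast (f : ℤ[X]) :
    Multiset.card (f.map (Int.castRingHom ℂ)).roots = f.natDegree := by
  rw [← (IsAlgClosed.splits (f.map (Int.castRingHom ℂ))).natDegree_eq_card_roots,
    natDegree_map_eq_of_injective (RingHom.injective_int _)]

open Polynomial in
theorem abs_eval_quotient_mul_pow_le {n h : ℕ} (hh : 1 ≤ h) {x y : Fin n → ℤ}
    (hx : x ∈ intBox n h) (hy : y ∈ intBox n h) {f Q : ℤ[X]} (hf : f ≠ 0)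
    (hQ : linProd x - linProd y = f * Q) {t : ℤ} (ht : 1 ≤ t ∧ t ≤ h) :
    ((|Q.eval (-t)| : ℤ) : ℝ) * (h : ℝ) ^ f.natDegree ≤
      2 * ((3 * f.natDegree + 2) ^ n * (h : ℝ) ^ n) := by
  set φ := Int.castRingHom ℂ
  set s := (f.map φ).roots with hs
  have hh0 : (0 : ℝ) < h := by exact_mod_cast hh
  set R : ℝ := (3 * f.natDegree + 1) * h with hR
  have hcard : Multiset.card s = f.natDegree := card_roots_map_intCast f
  have hlin {x : Fin n → ℤ} (hx : x ∈ intBox n h) {z : ℂ} (hz : ‖z‖ ≤ R) :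
      ‖((linProd x).map φ).eval z‖ ≤ (3 * f.natDegree + 2) ^ n * (h : ℝ) ^ n := by
    have : ((linProd x).map φ).eval z = ∏ i, ((x i : ℂ) + z) := by
      rw [← aeval_linProd, eval_map, aeval_def]; rfl
    rw [this, norm_prod, ← mul_pow]
    calc ∏ i, ‖(x i : ℂ) + z‖ ≤ ∏ _i : Fin n, ((3 * f.natDegree + 2) * h : ℝ) := by
          refine Finset.prod_le_prod (fun _ _ => norm_nonneg _) fun i _ => ?_
          refine (norm_add_le _ _).trans ?_
          have h1 := mem_intBox.1 hx i
          have h2 : ‖(x i : ℂ)‖ ≤ h := by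
            rw [Complex.norm_intCast, abs_of_nonneg (by exact_mod_cast (by lia : 0 ≤ x i))]
            exact_mod_cast h1.2
          rw [hR] at hz
          linarith
      _ = _ := by simp
  have key := norm_eval_mul_pow_le_of_prod_mul s (C (f.leadingCoeff : ℂ) * Q.map φ) (R := R)
    (B := 2 * ((3 * f.natDegree + 2) ^ n * (h : ℝ) ^ n)) hh0 (fun z hz => ?_) ((-t : ℤ) : ℂ) ?_
  · rw [hcard] at key
    refine le_trans ?_ key
    gcongr
    rw [eval_mul, eval_C, norm_mul, eval_intCast_map, Complex.norm_intCast]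
    have : (1 : ℝ) ≤ ‖(f.leadingCoeff : ℂ)‖ := by
      rw [Complex.norm_intCast]
      exact_mod_cast Int.one_le_abs (leadingCoeff_ne_zero.2 hf)
    have h3 := le_mul_of_one_le_left (abs_nonneg ((Q.eval (-t) : ℤ) : ℝ)) this
    simpa [φ] using h3
  · have : (s.map fun r => X - C r).prod * (C (f.leadingCoeff : ℂ) * Q.map φ)
        = (linProd x).map φ - (linProd y).map φ := by
      rw [← Polynomial.map_sub, hQ, Polynomial.map_mul,
        map_intCast_eq_leadingCoeff_mul_prod_roots f]
      ring
    rw [this, eval_sub, two_mul]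
    exact (norm_sub_le _ _).trans (add_le_add (hlin hx hz) (hlin hy hz))
  · rw [hcard, hR, Complex.norm_intCast]
    push_cast
    rw [abs_neg, abs_of_nonneg (by exact_mod_cast (by lia : 0 ≤ t))]
    have : (t : ℝ) ≤ h := by exact_mod_cast ht.2
    nlinarith

open Polynomial in
theorem prod_eval_neg_eq_of_dvd_linProd_sub {n : ℕ} {x y : Fin n → ℤ} {f : ℤ[X]}
    (h : f ∣ linProd x - linProd y) : ∏ i, f.eval (-x i) = ∏ i, f.eval (-y i) := by
  set φ := Int.castRingHom ℂ
  have hprod (x : Fin n → ℤ) : ((∏ i, f.eval (-x i) : ℤ) : ℂ) = (f.leadingCoeff : ℂ) ^ n *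
      ((f.map φ).roots.map fun r => (-1) ^ n * aeval r (linProd x)).prod := by
    have h1 (i : Fin n) : ((f.eval (-x i) : ℤ) : ℂ) =
        f.leadingCoeff * ((f.map φ).roots.map fun r => -((x i : ℂ) + r)).prod := by
      have : ((f.eval (-x i) : ℤ) : ℂ) = (f.map φ).eval ((-x i : ℤ) : ℂ) := by
        rw [eval_intCast_map]; rfl
      rw [this, map_intCast_eq_leadingCoeff_mul_prod_roots f, eval_mul, eval_C,
        eval_multiset_prod, Multiset.map_map]
      congr 2
      rw [← map_intCast_eq_leadingCoeff_mul_prod_roots f]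
      refine Multiset.map_congr rfl fun r _ => ?_
      simp only [Function.comp_apply, eval_sub, eval_X, eval_C]
      push_cast
      ring
    push_cast
    rw [Finset.prod_congr rfl fun i _ => h1 i, Finset.prod_mul_distrib, Finset.prod_const,
      Finset.card_univ, Fintype.card_fin, ← Multiset.prod_map_prod]
    congr 2
    refine Multiset.map_congr rfl fun r _ => ?_
    rw [aeval_linProd, Finset.prod_neg, Finset.card_univ, Fintype.card_fin]
  have hxy : (∏ i, f.eval (-x i) : ℤ) = ((∏ i, f.eval (-y i) : ℤ) : ℂ) := by
    rw [hprod, hprod]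
    congr 2
    refine Multiset.map_congr rfl fun r hr => ?_
    obtain ⟨Q, hQ⟩ := h
    have hr0 : aeval r f = 0 := by
      have := (mem_roots'.1 hr).2
      rwa [IsRoot.def, eval_map] at this
    have : aeval r (linProd x) - aeval r (linProd y) = 0 := by
      rw [← map_sub, hQ, map_mul, hr0, zero_mul]
    rw [sub_eq_zero.1 this]
  exact_mod_cast hxy

open Finset in
theorem exists_finset_of_int_dvd {N : ℤ} (hN : N ≠ 0) :
    ∃ S : Finset ℤ, (∀ m, m ∣ N → m ∈ S) ∧ #S ≤ 2 * #N.natAbs.divisors := by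
  refine ⟨N.natAbs.divisors.image (fun k : ℕ => (k : ℤ)) ∪
    N.natAbs.divisors.image (fun k : ℕ => -(k : ℤ)),
    fun m hm => ?_, ?_⟩
  · have h1 : m.natAbs ∈ N.natAbs.divisors :=
      Nat.mem_divisors.2 ⟨Int.natAbs_dvd_natAbs.2 hm, Int.natAbs_ne_zero.2 hN⟩
    rw [mem_union, mem_image, mem_image]
    rcases Int.natAbs_eq m with h | h
    · exact Or.inl ⟨_, h1, h.symm⟩
    · exact Or.inr ⟨_, h1, h.symm⟩
  · rw [two_mul]
    exact (card_union_le _ _).trans (add_le_add card_image_le card_image_le)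

open Polynomial Finset in
theorem exists_finset_of_eval_neg_eq {f : ℤ[X]} (hf : 0 < f.natDegree) (m : ℤ) :
    ∃ S : Finset ℤ, (∀ t, f.eval (-t) = m → t ∈ S) ∧ #S ≤ f.natDegree := by
  have hne : f - C m ≠ 0 := fun h => by
    rw [sub_eq_zero.1 h, natDegree_C] at hf
    exact hf.false
  refine ⟨(f - C m).roots.toFinset.image Neg.neg, fun t ht => ?_, ?_⟩
  · rw [mem_image]
    exact ⟨-t, Multiset.mem_toFinset.2 (mem_roots'.2 ⟨hne, by simp [IsRoot, ht]⟩), neg_neg t⟩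
  · calc _ ≤ #(f - C m).roots.toFinset := card_image_le
      _ ≤ Multiset.card (f - C m).roots := Multiset.toFinset_card_le _
      _ ≤ (f - C m).natDegree := card_roots' _
      _ = f.natDegree := natDegree_sub_C

open Polynomial in
open scoped Classical in
/-- Pairs of vectors in the box without common entries for which `f` divides the difference of the
associated products of linear polynomials. -/
noncomputable def disjointSolutions (f : ℤ[X]) (n h : ℕ) :
    Finset ((Fin n → ℤ) × (Fin n → ℤ)) :=
  (intBox n h ×ˢ intBox n h).filter fun p =>
    (∀ i j, p.1 i ≠ p.2 j) ∧ f ∣ linProd p.1 - linProd p.2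

open Polynomial in
open scoped Classical in
/-- Pairs of vectors in the box with distinct associated products of linear polynomials,
whose difference is divisible by `f`. -/
noncomputable def nontrivialSolutions (f : ℤ[X]) (n h : ℕ) :
    Finset ((Fin n → ℤ) × (Fin n → ℤ)) :=
  (intBox n h ×ˢ intBox n h).filter fun p =>
    linProd p.1 ≠ linProd p.2 ∧ f ∣ linProd p.1 - linProd p.2

theorem mem_disjointSolutions {f : Polynomial ℤ} {n h : ℕ} {p : (Fin n → ℤ) × (Fin n → ℤ)} :
    p ∈ disjointSolutions f n h ↔ (p.1 ∈ intBox n h ∧ p.2 ∈ intBox n h) ∧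
      (∀ i j, p.1 i ≠ p.2 j) ∧ f ∣ linProd p.1 - linProd p.2 := by
  simp only [disjointSolutions, Finset.mem_filter, Finset.mem_product]

theorem mem_nontrivialSolutions {f : Polynomial ℤ} {n h : ℕ} {p : (Fin n → ℤ) × (Fin n → ℤ)} :
    p ∈ nontrivialSolutions f n h ↔ (p.1 ∈ intBox n h ∧ p.2 ∈ intBox n h) ∧
      linProd p.1 ≠ linProd p.2 ∧ f ∣ linProd p.1 - linProd p.2 := by
  simp only [nontrivialSolutions, Finset.mem_filter, Finset.mem_product]

theorem prod_sub_natAbs_le {n h : ℕ} {x : Fin n → ℤ} (hx : x ∈ intBox n h) {t : ℤ}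
    (ht : 1 ≤ t ∧ t ≤ h) : (∏ i, (x i - t)).natAbs ≤ h ^ n := by
  rw [← Int.natAbsHom_apply, map_prod]
  calc ∏ i, Int.natAbsHom (x i - t) ≤ ∏ _i : Fin n, h := by
        refine Finset.prod_le_prod' fun i _ => ?_
        have := mem_intBox.1 hx i
        rw [Int.natAbsHom_apply]
        lia
    _ = h ^ n := by simp

theorem eval_neg_dvd_prod_sub {f : Polynomial ℤ} {n : ℕ} {x y : Fin n → ℤ}
    (h : f ∣ linProd x - linProd y) (j : Fin n) : f.eval (-y j) ∣ ∏ i, (x i - y j) := by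
  have := Polynomial.eval_dvd (x := -y j) h
  rwa [Polynomial.eval_sub, eval_neg_linProd_self, sub_zero, eval_neg_linProd] at this

open Polynomial Finset in
theorem card_disjointSolutions_le {f : ℤ[X]} (hf : 0 < f.natDegree) {n h K D : ℕ} (hh : 1 ≤ h)
    (hK : ∀ x ∈ intBox (n + 1) h, ∀ y ∈ intBox (n + 1) h, ∀ Q, linProd x - linProd y = f * Q →
      ∀ t : ℤ, 1 ≤ t ∧ t ≤ h → |Q.eval (-t)| ≤ K)
    (hD : ∀ m : ℕ, m ≠ 0 → m ≤ h ^ ((n + 1) * (n + 1)) → #m.divisors ≤ D) :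
    #(disjointSolutions f (n + 1) h) ≤
      (2 * D * f.natDegree) ^ (n + 1) * ((h * (2 * K)) * (2 * D) ^ (n + 1)) := by
  set A := disjointSolutions f (n + 1) h with hA
  have hne {x y : Fin (n + 1) → ℤ} (hxy : ∀ i j, x i ≠ y j) (j) : ∏ i, (x i - y j) ≠ 0 :=
    prod_ne_zero_iff.2 fun i _ => sub_ne_zero.2 (hxy i j)
  have hfibre : ∀ x ∈ A.image Prod.fst, #{p ∈ A | p.1 = x} ≤ (2 * D * f.natDegree) ^ (n + 1) := by
    intro x hx
    obtain ⟨p, hp, rfl⟩ := mem_image.1 hx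
    obtain ⟨⟨hx, hy⟩, hxy, hdvd⟩ := mem_disjointSolutions.1 hp
    have hdvd' := (dvd_sub_comm).1 hdvd
    have hfx (i) : f.eval (-p.1 i) ≠ 0 ∧ (f.eval (-p.1 i)).natAbs ≤ h ^ (n + 1) := by
      have h0 := hne (fun i j => (hxy j i).symm) i
      have h1 := eval_neg_dvd_prod_sub hdvd' i
      refine ⟨fun h2 => h0 (zero_dvd_iff.1 (h2 ▸ h1)), ?_⟩
      exact (Nat.le_of_dvd (Int.natAbs_pos.2 h0) (Int.natAbs_dvd_natAbs.2 h1)).trans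
        (prod_sub_natAbs_le hy (mem_intBox.1 hx i))
    set N : ℤ := ∏ i, f.eval (-p.1 i) with hN
    have hN0 : N ≠ 0 := prod_ne_zero_iff.2 fun i _ => (hfx i).1
    have hNle : N.natAbs ≤ h ^ ((n + 1) * (n + 1)) := by
      rw [hN, ← Int.natAbsHom_apply, map_prod, pow_mul]
      calc _ ≤ ∏ _i : Fin (n + 1), h ^ (n + 1) := prod_le_prod' fun i _ => (hfx i).2
        _ = _ := by simp
    obtain ⟨S, hS, hScard⟩ := exists_finset_of_int_dvd hN0
    choose V hV hVcard using exists_finset_of_eval_neg_eq hf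
    have hcard : #(S.biUnion V) ≤ 2 * D * f.natDegree := by
      refine (card_biUnion_le_card_mul _ _ _ fun m _ => hVcard m).trans ?_
      gcongr
      exact hScard.trans (by gcongr; exact hD _ (Int.natAbs_ne_zero.2 hN0) hNle)
    calc #{q ∈ A | q.1 = p.1} ≤ #(Fintype.piFinset fun _ : Fin (n + 1) => S.biUnion V) := by
          refine card_le_card_of_injOn Prod.snd (fun q hq => ?_) fun q hq q' hq' hqq' => ?_
          · obtain ⟨hqA, hqx⟩ := mem_filter.1 hq
            obtain ⟨-, -, hqdvd⟩ := mem_disjointSolutions.1 hqA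
            refine Fintype.mem_piFinset.2 fun i =>
              mem_biUnion.2 ⟨f.eval (-q.2 i), hS _ ?_, hV _ _ rfl⟩
            rw [hN, ← hqx, prod_eval_neg_eq_of_dvd_linProd_sub hqdvd]
            exact dvd_prod_of_mem (fun i => f.eval (-q.2 i)) (mem_univ i)
          · exact Prod.ext ((mem_filter.1 hq).2.trans (mem_filter.1 hq').2.symm) hqq'
      _ = #(S.biUnion V) ^ (n + 1) := by simp
      _ ≤ _ := by gcongr
  refine (card_le_mul_card_image _ _ hfibre).trans (Nat.mul_le_mul_left _ ?_)
  let g : (Fin (n + 1) → ℤ) × (Fin (n + 1) → ℤ) → ℤ × ℤ := fun p =>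
    (p.2 0, (∏ i, (p.1 i - p.2 0)) / f.eval (-p.2 0))
  have hg {p} (hp : p ∈ A) : (g p).2 * f.eval (-(g p).1) = ∏ i, (p.1 i - (g p).1) :=
    Int.ediv_mul_cancel (eval_neg_dvd_prod_sub (mem_disjointSolutions.1 hp).2.2 0)
  have hT : ∀ c ∈ A.image g, ∃ T : Finset (Fin (n + 1) → ℤ),
      (∀ p ∈ A, g p = c → p.1 ∈ T) ∧ #T ≤ (2 * D) ^ (n + 1) := by
    intro c hc
    obtain ⟨p, hp, rfl⟩ := mem_image.1 hc
    obtain ⟨⟨hx, hy⟩, hxy, hdvd⟩ := mem_disjointSolutions.1 hp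
    obtain ⟨S, hS, hScard⟩ := exists_finset_of_int_dvd (hne hxy 0)
    refine ⟨Fintype.piFinset fun _ => S.image (· + p.2 0), fun q hq hqp => ?_, ?_⟩
    · refine Fintype.mem_piFinset.2 fun i => mem_image.2 ⟨q.1 i - p.2 0, hS _ ?_, by simp⟩
      have h1 := hg hq
      rw [hqp, hg hp] at h1
      exact h1 ▸ dvd_prod_of_mem (fun i => q.1 i - p.2 0) (mem_univ i)
    · rw [Fintype.card_piFinset_const]
      refine Nat.pow_le_pow_left (card_image_le.trans (hScard.trans ?_)) _
      gcongr
      refine hD _ (Int.natAbs_ne_zero.2 (hne hxy 0))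
        ((prod_sub_natAbs_le hx (mem_intBox.1 hy 0)).trans ?_)
      exact Nat.pow_le_pow_right hh (Nat.le_mul_of_pos_left _ n.succ_pos)
  choose! T hT hTcard using hT
  have himage : #(A.image g) ≤ h * (2 * K) := by
    calc #(A.image g) ≤ #(Icc 1 (h : ℤ) ×ˢ (Icc (-K : ℤ) K).erase 0) := by
          refine card_le_card fun c hc => ?_
          obtain ⟨p, hp, rfl⟩ := mem_image.1 hc
          obtain ⟨⟨hx, hy⟩, hxy, Q, hQ⟩ := mem_disjointSolutions.1 hp
          have h0 := mem_intBox.1 hy 0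
          have hp0 := hne hxy 0
          have hgp := hg hp
          have hfy : f.eval (-p.2 0) ≠ 0 := fun h => by
            simp only [g, h, mul_zero] at hgp
            exact hp0 hgp.symm
          have hgQ : (g p).2 = Q.eval (-p.2 0) := by
            have h1 := congrArg (eval (-p.2 0)) hQ
            rw [eval_sub, eval_neg_linProd_self, sub_zero, eval_neg_linProd, eval_mul,
              mul_comm] at h1
            exact mul_right_cancel₀ hfy (hgp.trans h1)
          rw [mem_product, mem_Icc, mem_erase, mem_Icc, ← abs_le]
          refine ⟨h0, fun h => ?_, hgQ ▸ hK _ hx _ hy Q hQ _ h0⟩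
          rw [h, zero_mul] at hgp
          exact hp0 hgp.symm
      _ = h * (2 * K) := by
          rw [card_product, card_erase_of_mem (by simp), Int.card_Icc, Int.card_Icc]
          congr 1 <;> lia
  calc #(A.image Prod.fst) ≤ #((A.image g).biUnion T) := by
        refine card_le_card fun x hx => ?_
        obtain ⟨p, hp, rfl⟩ := mem_image.1 hx
        exact mem_biUnion.2 ⟨g p, mem_image_of_mem g hp, hT _ (mem_image_of_mem g hp) p hp rfl⟩
    _ ≤ #(A.image g) * (2 * D) ^ (n + 1) := card_biUnion_le_card_mul _ _ _ hTcard
    _ ≤ _ := by gcongr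

open Polynomial Finset in
theorem card_nontrivialSolutions_succ_le {f : ℤ[X]} (hprime : Prime f) (hf : 2 ≤ f.natDegree)
    (n h : ℕ) :
    #(nontrivialSolutions f (n + 1) h) ≤ #(disjointSolutions f (n + 1) h) +
      (n + 1) * (n + 1) * h * #(nontrivialSolutions f n h) := by
  classical
  let insertPair : (Fin (n + 1) × Fin (n + 1)) × ℤ → (Fin n → ℤ) × (Fin n → ℤ) →
      (Fin (n + 1) → ℤ) × (Fin (n + 1) → ℤ) :=
    fun c p => (c.1.1.insertNth c.2 p.1, c.1.2.insertNth c.2 p.2)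
  let I : Finset ((Fin (n + 1) × Fin (n + 1)) × ℤ) := univ ×ˢ Icc 1 (h : ℤ)
  have hsub : nontrivialSolutions f (n + 1) h ⊆ disjointSolutions f (n + 1) h ∪
      I.biUnion fun c => (nontrivialSolutions f n h).image (insertPair c) := by
    rintro ⟨x, y⟩ hp
    obtain ⟨⟨hx, hy⟩, hne, hdvd⟩ := mem_nontrivialSolutions.1 hp
    dsimp only at hx hy hne hdvd
    by_cases hxy : ∀ i j, x i ≠ y j
    · exact mem_union_left _ (mem_disjointSolutions.2 ⟨⟨hx, hy⟩, hxy, hdvd⟩)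
    · push Not at hxy
      obtain ⟨i, j, hij⟩ := hxy
      refine mem_union_right _ (mem_biUnion.2 ⟨((i, j), x i), ?_, mem_image.2
        ⟨(i.removeNth x, j.removeNth y), ?_, ?_⟩⟩)
      · exact mem_product.2 ⟨mem_univ _, mem_Icc.2 (mem_intBox.1 hx i)⟩
      · have hx' : linProd x = (X + C (x i)) * linProd (i.removeNth x) := by
          rw [← linProd_insertNth i, Fin.insertNth_self_removeNth]
        have hy' : linProd y = (X + C (x i)) * linProd (j.removeNth y) := by
          rw [← linProd_insertNth j, hij, Fin.insertNth_self_removeNth]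
        refine mem_nontrivialSolutions.2 ⟨⟨mem_intBox.2 fun k => mem_intBox.1 hx _,
          mem_intBox.2 fun k => mem_intBox.1 hy _⟩, fun h => hne ?_, ?_⟩
        · rw [hx', hy', h]
        · rw [hx', hy', ← mul_sub] at hdvd
          refine (hprime.dvd_or_dvd hdvd).resolve_left fun h => ?_
          have := natDegree_le_of_dvd h (X_add_C_ne_zero _)
          rw [natDegree_X_add_C] at this
          lia
      · simp only [insertPair, Fin.insertNth_self_removeNth]
        rw [hij, Fin.insertNth_self_removeNth]
  refine (card_le_card hsub).trans ((card_union_le _ _).trans (Nat.add_le_add_left ?_ _))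
  refine (card_biUnion_le_card_mul _ _ _ fun _ _ => card_image_le).trans (le_of_eq ?_)
  simp [I]

open Finset in
theorem card_nontrivialSolutions_zero (f : Polynomial ℤ) (h : ℕ) :
    #(nontrivialSolutions f 0 h) = 0 := by
  rw [card_eq_zero, eq_empty_iff_forall_notMem]
  intro p hp
  exact (mem_nontrivialSolutions.1 hp).2.1 (by rw [Subsingleton.elim p.1 p.2])

theorem succ_le_one_add_mul_rpow {ε : ℝ} (hε : 0 < ε) (a : ℕ) :
    (a + 1 : ℝ) ≤ (1 + 1 / (ε * Real.log 2)) * ((2 : ℝ) ^ a) ^ ε := by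
  have hl : 0 < ε * Real.log 2 := mul_pos hε (Real.log_pos (by norm_num))
  have h1 : 1 + a * (ε * Real.log 2) ≤ ((2 : ℝ) ^ a) ^ ε := by
    rw [Real.rpow_def_of_pos (by positivity), Real.log_pow]
    have := Real.add_one_le_exp (a * Real.log 2 * ε)
    linarith
  have h2 : (0 : ℝ) ≤ a := Nat.cast_nonneg a
  calc (a + 1 : ℝ) ≤ (1 + 1 / (ε * Real.log 2)) * (1 + a * (ε * Real.log 2)) := by
        have : (1 + 1 / (ε * Real.log 2)) * (1 + a * (ε * Real.log 2))
          = a + 1 + (a * (ε * Real.log 2) + 1 / (ε * Real.log 2)) := by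
          field_simp
          ring
        rw [this]
        have : 0 ≤ a * (ε * Real.log 2) + 1 / (ε * Real.log 2) := by positivity
        linarith
    _ ≤ _ := by gcongr

open Finset in
theorem Nat.card_divisors_le_pow_mul_rpow {n : ℕ} (hn : n ≠ 0) {ε : ℝ} (hε : 0 < ε) {m : ℕ}
    (hm : 2 ≤ ((m : ℝ) + 1) ^ ε) :
    (#n.divisors : ℝ) ≤ (1 + 1 / (ε * Real.log 2)) ^ m * (n : ℝ) ^ ε := by
  set K : ℝ := 1 + 1 / (ε * Real.log 2) with hK
  have hl : 0 < ε * Real.log 2 := mul_pos hε (Real.log_pos (by norm_num))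
  have hK1 : 1 ≤ K := by rw [hK]; linarith [one_div_pos.2 hl]
  have hterm : ∀ p ∈ n.primeFactors, ((n.factorization p + 1 : ℕ) : ℝ) ≤
      (if p ≤ m then K else 1) * ((p : ℝ) ^ n.factorization p) ^ ε := by
    intro p hp
    have hp2 : (2 : ℝ) ≤ p := by exact_mod_cast (Nat.prime_of_mem_primeFactors hp).two_le
    push_cast
    split_ifs with h
    · refine (succ_le_one_add_mul_rpow hε _).trans ?_
      gcongr
    · have h3 : (2 : ℝ) ≤ (p : ℝ) ^ ε := by
        refine hm.trans ?_
        gcongr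
        exact_mod_cast not_le.1 h
      rw [one_mul, ← Real.rpow_natCast, ← Real.rpow_mul (by positivity), mul_comm,
        Real.rpow_mul (by positivity), Real.rpow_natCast]
      calc ((n.factorization p : ℝ) + 1) ≤ (2 : ℝ) ^ n.factorization p := by
            exact_mod_cast Nat.lt_two_pow_self
        _ ≤ _ := by gcongr
  rw [Nat.card_divisors hn, Nat.cast_prod]
  calc _ ≤ ∏ p ∈ n.primeFactors, ((if p ≤ m then K else 1) * ((p : ℝ) ^ n.factorization p) ^ ε) :=
        Finset.prod_le_prod (fun _ _ => Nat.cast_nonneg _) hterm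
    _ = (∏ p ∈ n.primeFactors, if p ≤ m then K else 1) * (n : ℝ) ^ ε := by
        rw [Finset.prod_mul_distrib, Real.finsetProd_rpow _ _ (fun p _ => by positivity)]
        congr 2
        conv_rhs => rw [← Nat.prod_factorization_pow_eq_self hn]
        rw [Finsupp.prod, Nat.support_factorization]
        push_cast
        rfl
    _ ≤ _ := by
        gcongr
        rw [Finset.prod_ite, Finset.prod_const, Finset.prod_const_one, mul_one]
        refine pow_le_pow_right₀ hK1 ?_
        calc _ ≤ #(Finset.Icc 1 m) := by
              refine Finset.card_le_card fun p hp => ?_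
              rw [Finset.mem_filter] at hp
              exact Finset.mem_Icc.2 ⟨(Nat.prime_of_mem_primeFactors hp.1).one_le, hp.2⟩
          _ = m := by simp

theorem one_lt_log_three : 1 < Real.log 3 := by
  rw [Real.lt_log_iff_exp_lt (by norm_num)]
  linarith [Real.exp_one_lt_d9]

open Finset in
theorem Nat.card_divisors_le_exp_log_div_log_log (k : ℕ) :
    ∃ C : ℝ, 0 < C ∧ ∀ h : ℕ, 3 ≤ h → ∀ n : ℕ, n ≠ 0 → n ≤ h ^ k →
      (#n.divisors : ℝ) ≤ Real.exp (C * Real.log h / Real.log (Real.log h)) := by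
  refine ⟨2 * k + 64, by positivity, fun h hh n hn hnk => ?_⟩
  have hL : 1 < Real.log h := one_lt_log_three.trans_le
    (Real.log_le_log (by norm_num) (by exact_mod_cast hh))
  set L := Real.log h with hLdef
  have hl : 0 < Real.log L := Real.log_pos hL
  set l := Real.log L with hldef
  have hlog2 : 0.69 < Real.log 2 := by linarith [Real.log_two_gt_d9]
  have hlog2' : Real.log 2 < 0.7 := by linarith [Real.log_two_lt_d9]
  have hε : 0 < 2 * Real.log 2 / l := by positivity
  have hm : 2 ≤ ((⌊√L⌋₊ : ℝ) + 1) ^ (2 * Real.log 2 / l) := by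
    calc (2 : ℝ) = (√L) ^ (2 * Real.log 2 / l) := by
          rw [Real.rpow_def_of_pos (by positivity), Real.log_sqrt (by positivity), ← hldef]
          rw [show l / 2 * (2 * Real.log 2 / l) = Real.log 2 by field_simp,
            Real.exp_log (by norm_num)]
      _ ≤ _ := by
          gcongr
          exact (Nat.lt_floor_add_one _).le
  refine (Nat.card_divisors_le_pow_mul_rpow hn hε hm).trans ?_
  have h1 : (n : ℝ) ^ (2 * Real.log 2 / l) ≤ Real.exp (2 * k * L / l) := by
    calc (n : ℝ) ^ (2 * Real.log 2 / l) ≤ ((h : ℝ) ^ k) ^ (2 * Real.log 2 / l) := by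
          gcongr
          exact_mod_cast hnk
      _ = Real.exp (k * L * (2 * Real.log 2 / l)) := by
          rw [Real.rpow_def_of_pos (by positivity), Real.log_pow]
      _ ≤ _ := by
          apply Real.exp_le_exp.2
          rw [mul_div_assoc', div_le_div_iff_of_pos_right hl]
          have : 0 ≤ k * L := by positivity
          nlinarith
  have h2 : (1 + 1 / (2 * Real.log 2 / l * Real.log 2)) ^ ⌊√L⌋₊ ≤ Real.exp (64 * L / l) := by
    have h3 : 1 + 1 / (2 * Real.log 2 / l * Real.log 2) ≤ Real.exp (2 * l) := by
      have : 1 / (2 * Real.log 2 / l * Real.log 2) ≤ 2 * l := by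
        rw [show 1 / (2 * Real.log 2 / l * Real.log 2) = l / (2 * Real.log 2 ^ 2) by field_simp,
          div_le_iff₀ (by positivity)]
        nlinarith [mul_pos hl (show 0 < 4 * Real.log 2 ^ 2 - 1 by nlinarith)]
      linarith [Real.add_one_le_exp (2 * l)]
    calc _ ≤ Real.exp (2 * l) ^ ⌊√L⌋₊ := by gcongr
      _ = Real.exp (⌊√L⌋₊ * (2 * l)) := by rw [← Real.exp_nat_mul]
      _ ≤ _ := by
        apply Real.exp_le_exp.2
        have h4 : (⌊√L⌋₊ : ℝ) ≤ √L := Nat.floor_le (Real.sqrt_nonneg _)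
        have h5 : l ≤ 4 * √(√L) := by
          have : Real.log (√(√L)) = l / 4 := by
            rw [Real.log_sqrt (by positivity), Real.log_sqrt (by positivity)]
            ring
          have h6 := Real.log_le_sub_one_of_pos (show 0 < √(√L) by positivity)
          linarith
        have h7 : l ^ 2 ≤ 16 * √L := by
          calc l ^ 2 ≤ (4 * √(√L)) ^ 2 := by gcongr
            _ = _ := by rw [mul_pow, Real.sq_sqrt (by positivity)]; norm_num
        rw [le_div_iff₀ hl]
        calc _ ≤ √L * (2 * l) * l := by gcongr
          _ = 2 * √L * l ^ 2 := by ring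
          _ ≤ 2 * √L * (16 * √L) := by gcongr
          _ = 32 * (√L * √L) := by ring
          _ = 32 * L := by rw [Real.mul_self_sqrt (by positivity)]
          _ ≤ 64 * L := by linarith
  calc _ ≤ Real.exp (64 * L / l) * Real.exp (2 * k * L / l) := by gcongr
    _ = _ := by rw [← Real.exp_add]; congr 1; ring

theorem one_le_log_div_log_log {h : ℕ} (hh : 3 ≤ h) :
    1 ≤ Real.log h / Real.log (Real.log h) := by
  have hL : 1 < Real.log h := one_lt_log_three.trans_le
    (Real.log_le_log (by norm_num) (by exact_mod_cast hh))
  rw [one_le_div (Real.log_pos hL)]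
  linarith [Real.log_le_sub_one_of_pos (zero_lt_one.trans hL)]

open Polynomial Finset in
theorem exists_card_nontrivialSolutions_mul_pow_le {d : ℕ} (hd : 2 ≤ d) (n : ℕ) :
    ∃ C : ℝ, 0 < C ∧ ∀ h : ℕ, 3 ≤ h → ∀ f : ℤ[X], Prime f → f.natDegree = d →
      (#(nontrivialSolutions f n h) : ℝ) * (h : ℝ) ^ d ≤
        (h : ℝ) ^ (n + 1) * Real.exp (C * Real.log h / Real.log (Real.log h)) := by
  induction n with
  | zero =>
    refine ⟨1, one_pos, fun h hh f hf hfd => ?_⟩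
    rw [card_nontrivialSolutions_zero, Nat.cast_zero, zero_mul]
    positivity
  | succ n ih =>
    obtain ⟨C₁, hC₁, h₁⟩ := ih
    obtain ⟨C₂, hC₂, h₂⟩ := Nat.card_divisors_le_exp_log_div_log_log ((n + 1) * (n + 1))
    set a : ℝ := (2 * d) ^ (n + 1) * 2 ^ (n + 1) * (4 * (3 * d + 2) ^ (n + 1)) with ha
    set b : ℝ := (n + 1) * (n + 1) with hb
    have ha0 : 0 < a := by positivity
    have hb0 : 0 < b := by positivity
    refine ⟨a + b + (C₁ + (2 * (n + 1) : ℕ) * C₂), by positivity, fun h hh f hf hfd => ?_⟩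
    have hE := one_le_log_div_log_log hh
    simp only [mul_div_assoc] at h₁ h₂ ⊢
    specialize h₁ h hh f hf hfd
    specialize h₂ h hh
    set E := Real.log h / Real.log (Real.log h)
    have hh0 : (0 : ℝ) < h := by exact_mod_cast (by lia : 0 < h)
    set D := ⌊Real.exp (C₂ * E)⌋₊
    set M : ℝ := 2 * ((3 * d + 2) ^ (n + 1) * (h : ℝ) ^ (n + 1)) with hM
    set K := ⌊M / (h : ℝ) ^ d⌋₊
    have hDle : (D : ℝ) ≤ Real.exp (C₂ * E) := Nat.floor_le (Real.exp_pos _).le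
    have hKle : (K : ℝ) * (h : ℝ) ^ d ≤ M := by
      rw [← le_div_iff₀ (by positivity)]
      exact Nat.floor_le (by positivity)
    have hdisj := card_disjointSolutions_le (f := f) (n := n) (h := h) (K := K) (D := D)
      (by lia) (by lia) (fun x hx y hy Q hQ t ht => by
        have h3 := abs_eval_quotient_mul_pow_le (by lia) hx hy hf.ne_zero hQ ht
        rw [hfd, ← le_div_iff₀ (by positivity)] at h3
        rw [Int.abs_eq_natAbs, Int.cast_natCast] at h3
        rw [Int.abs_eq_natAbs]
        exact Int.ofNat_le.2 (Nat.le_floor h3))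
      (fun m hm hmh => Nat.le_floor (h₂ m hm hmh))
    have hsucc := card_nontrivialSolutions_succ_le hf (by lia) n h
    rw [hfd] at hdisj
    have hdisj' : (#(disjointSolutions f (n + 1) h) : ℝ) * (h : ℝ) ^ d ≤
        (h : ℝ) ^ (n + 2) * (a * Real.exp ((2 * (n + 1) : ℕ) * C₂ * E)) := by
      calc _ ≤ ((2 * D * d : ℝ) ^ (n + 1) * ((h * (2 * K)) * (2 * D) ^ (n + 1))) *
            (h : ℝ) ^ d := by gcongr; exact_mod_cast hdisj
        _ = (2 * D * d : ℝ) ^ (n + 1) * (h * 2 * (K * (h : ℝ) ^ d) * (2 * D) ^ (n + 1)) := by ring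
        _ ≤ (2 * Real.exp (C₂ * E) * d) ^ (n + 1) *
            (h * 2 * M * (2 * Real.exp (C₂ * E)) ^ (n + 1)) := by gcongr
        _ = (h : ℝ) ^ (n + 2) * (a * Real.exp (C₂ * E) ^ (2 * (n + 1))) := by
            rw [ha, hM]
            ring
        _ = _ := by rw [← Real.exp_nat_mul, mul_assoc _ C₂ E]
    have hconst : a + b ≤ Real.exp ((a + b) * E) := by
      have h4 := Real.add_one_le_exp ((a + b) * E)
      nlinarith
    calc _ ≤ ((#(disjointSolutions f (n + 1) h) : ℝ) +
          (n + 1) * (n + 1) * h * #(nontrivialSolutions f n h)) * (h : ℝ) ^ d := by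
          gcongr
          exact_mod_cast hsucc
      _ = (#(disjointSolutions f (n + 1) h) : ℝ) * (h : ℝ) ^ d +
          b * h * (#(nontrivialSolutions f n h) * (h : ℝ) ^ d) := by rw [hb]; ring
      _ ≤ (h : ℝ) ^ (n + 2) * (a * Real.exp ((2 * (n + 1) : ℕ) * C₂ * E)) +
          b * h * ((h : ℝ) ^ (n + 1) * Real.exp (C₁ * E)) := by gcongr
      _ = (h : ℝ) ^ (n + 2) * (a * Real.exp ((2 * (n + 1) : ℕ) * C₂ * E) +
          b * Real.exp (C₁ * E)) := by ring
      _ ≤ (h : ℝ) ^ (n + 2) * (a * Real.exp ((C₁ + (2 * (n + 1) : ℕ) * C₂) * E) +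
          b * Real.exp ((C₁ + (2 * (n + 1) : ℕ) * C₂) * E)) := by
          have : 0 ≤ ((2 * (n + 1) : ℕ) : ℝ) * C₂ := by positivity
          gcongr <;> linarith
      _ = (h : ℝ) ^ (n + 2) * ((a + b) * Real.exp ((C₁ + (2 * (n + 1) : ℕ) * C₂) * E)) := by ring
      _ ≤ (h : ℝ) ^ (n + 2) * (Real.exp ((a + b) * E) *
          Real.exp ((C₁ + (2 * (n + 1) : ℕ) * C₂) * E)) := by gcongr
      _ = _ := by rw [← Real.exp_add, ← add_mul]

open Polynomial in
theorem prime_of_aeval_eq_zero_iff_dvd {σ : ℂ} {f : ℤ[X]} (hf : f.natDegree ≠ 0)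
    (h : ∀ P : ℤ[X], aeval σ P = 0 ↔ f ∣ P) : Prime f := by
  refine ⟨fun h0 => hf (by simp [h0]), fun hu => hf (natDegree_eq_zero_of_isUnit hu),
    fun P Q hPQ => ?_⟩
  rw [← h, map_mul, mul_eq_zero, h, h] at hPQ
  exact hPQ

/-- For fixed `ν ≥ d ≥ 2` there is `C = C(ν) > 0` such that for every `h ≥ 3` and
every algebraic number `σ ∈ ℂ` of degree `d` over `ℚ`, the number of nontrivial solutions of
`(x₁+σ)⋯(x_ν+σ) = (y₁+σ)⋯(y_ν+σ) ≠ 0` with `1 ≤ xᵢ, yᵢ ≤ h` is at most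
`h^{ν-d+1} exp(C log h / log log h)`. -/
theorem stmt2 (ν d : ℕ) (hd : 2 ≤ d) (hdν : d ≤ ν) :
    ∃ C : ℝ, 0 < C ∧ ∀ h : ℕ, 3 ≤ h → ∀ σ : ℂ,
      IsIntegral ℚ σ → (minpoly ℚ σ).natDegree = d →
      (Set.ncard {xy : (Fin ν → ℤ) × (Fin ν → ℤ) |
          (∀ i, 1 ≤ xy.1 i ∧ xy.1 i ≤ (h : ℤ)) ∧
          (∀ i, 1 ≤ xy.2 i ∧ xy.2 i ≤ (h : ℤ)) ∧
          (∏ i, ((xy.1 i : ℂ) + σ)) = (∏ i, ((xy.2 i : ℂ) + σ)) ∧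
          (∏ i, ((xy.1 i : ℂ) + σ)) ≠ 0 ∧
          ¬ ∃ e : Equiv.Perm (Fin ν), ∀ i, xy.2 i = xy.1 (e i)} : ℝ)
        ≤ (h : ℝ) ^ (ν - d + 1) * Real.exp (C * Real.log h / Real.log (Real.log h)) := by
  obtain ⟨C, hC, hbound⟩ := exists_card_nontrivialSolutions_mul_pow_le hd ν
  refine ⟨C, hC, fun h hh σ hσ hdeg => ?_⟩
  obtain ⟨f, hfdeg, hf⟩ := exists_int_polynomial_dvd_iff_aeval_eq_zero hσ
  rw [hdeg] at hfdeg
  have hprime := prime_of_aeval_eq_zero_iff_dvd (by lia) hf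
  have hh0 : (0 : ℝ) < h := by exact_mod_cast (by lia : 0 < h)
  refine le_of_mul_le_mul_right (le_trans ?_ (hbound h hh f hprime hfdeg |>.trans_eq ?_))
    (pow_pos hh0 d)
  · gcongr
    rw [← Set.ncard_coe_finset]
    refine Set.ncard_le_ncard ?_ (Finset.finite_toSet _)
    rintro ⟨x, y⟩ ⟨hx, hy, hxy, -, hnt⟩
    refine Finset.mem_coe.2 (mem_nontrivialSolutions.2
      ⟨⟨mem_intBox.2 hx, mem_intBox.2 hy⟩, fun h => hnt (exists_perm_of_linProd_eq h), ?_⟩)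
    rw [← hf, map_sub, aeval_linProd, aeval_linProd, sub_eq_zero]
    exact hxy
  · rw [show ν + 1 = ν - d + 1 + d by lia, pow_add]
    ring
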